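/- arXiv:1112.5378 — 3 statements merged into one kernel-verified Lean document; each statement's English description precedes it below -/
import Mathlib

section
/- Let q be a power of a prime p, let L be a field extension of the rational function field 𝔽_q(T), let r ≥ 1, and let A_1,…,A_r ∈ L with A_0 := T. Define, for n ≥ 0, α_n := ∑_{S ∈ P_r(n)} A^S / D_n(∪S). Then α_0 = 1 and for every n ≥ 1 the recursion α_n T^{q^n} = ∑_{i=0}^{r} A_i α_{n−i}^{q^i} holds (with α_k := 0 for k < 0); moreover (α_n)_{n≥0} is the unique sequence in L with α_0 = 1 satisfying this recursion. These α_n are the coefficients of the exponential series e_φ(z) = ∑ α_n z^{q^n} of the rank-r Drinfeld module φ_T = T + A_1τ + … + A_rτ^r. -/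
/-- `SP r n S`: the `r`-tuple `S` (with `S i` playing the role of `S_{i+1}`) of subsets of
`{0, …, n-1}` is an order-`r` shadowed partition of `n`. -/
def SP (r n : ℕ) (S : Fin r → Finset ℕ) : Prop :=
  (∀ p q : Σ i : Fin r, Fin ((i : ℕ) + 1), p ≠ q →
      Disjoint ((S p.1).image (· + (p.2 : ℕ))) ((S q.1).image (· + (q.2 : ℕ)))) ∧
    (Finset.univ : Finset (Σ i : Fin r, Fin ((i : ℕ) + 1))).biUnion
        (fun p => (S p.1).image (· + (p.2 : ℕ))) = Finset.range n

/-- `P_r(n)` as a finite set: all order-`r` shadowed partitions of `n`. -/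
noncomputable def SPart (r n : ℕ) : Finset (Fin r → Finset ℕ) :=
  @Finset.filter _ (fun S => SP r n S) (Classical.decPred _)
    (Fintype.piFinset fun _ : Fin r => (Finset.range n).powerset)

/-- The coefficients `α_n = ∑_{S ∈ P_r(n)} A^S / D_n(∪S)` of the exponential series of the
rank-`r` Drinfeld module `φ_T = T + A_1 τ + ⋯ + A_r τ^r` (here `A i = A_{i+1}`), where
`A^S = ∏_i A_i^{w(S_i)}` with `w(S) = ∑_{j ∈ S} q^j`, and
`D_n(S) = ∏_{i ∈ S} [n-i]^{q^i}` with `[m] = T^{q^m} - T`. -/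
noncomputable def expCoeff (q : ℕ) {L : Type*} [Field L] (T : L) {r : ℕ}
    (A : Fin r → L) (n : ℕ) : L :=
  ∑ S ∈ SPart r n,
    (∏ i : Fin r, A i ^ ∑ j ∈ S i, q ^ j) /
      ∏ i ∈ Finset.univ.biUnion S, (T ^ q ^ (n - i) - T) ^ q ^ i

/-- A tuple is a shadowed partition iff the intervals `[s, s + i]`, for `s ∈ S i`, tile
`{0, …, n-1}`. -/
theorem SP_iff (r n : ℕ) (S : Fin r → Finset ℕ) :
    SP r n S ↔ (∀ i : Fin r, ∀ s ∈ S i, s + i < n) ∧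
      (∀ x < n, ∃ i : Fin r, ∃ s ∈ S i, s ≤ x ∧ x ≤ s + i) ∧
      (∀ i i' : Fin r, ∀ s ∈ S i, ∀ s' ∈ S i', s ≤ s' → s' ≤ s + i → i = i' ∧ s = s') := by
  unfold SP
  constructor
  · rintro ⟨hd, hu⟩
    have hu' := fun x => Finset.ext_iff.1 hu x
    simp only [Finset.mem_biUnion, Finset.mem_univ, true_and, Finset.mem_image,
      Finset.mem_range, Sigma.exists] at hu'
    refine ⟨fun i s hs => (hu' _).1 ⟨i, ⟨i, by omega⟩, s, hs, rfl⟩, fun x hx => ?_, ?_⟩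
    · obtain ⟨i, j, s, hs, rfl⟩ := (hu' x).2 hx
      exact ⟨i, s, hs, by omega, by omega⟩
    · intro i i' s hs s' hs' h1 h2
      by_contra hne
      have := hd ⟨i, ⟨s' - s, by omega⟩⟩ ⟨i', ⟨0, by omega⟩⟩ (by
        intro h
        obtain ⟨rfl, h⟩ := Sigma.mk.inj_iff.1 h
        have := congrArg Fin.val (eq_of_heq h)
        simp only at this
        exact hne ⟨rfl, by omega⟩)
      exact Finset.disjoint_left.1 this
        (Finset.mem_image.2 ⟨s, hs, show s + (s' - s) = s' by omega⟩)
        (Finset.mem_image.2 ⟨s', hs', rfl⟩)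
  · rintro ⟨hb, hc, hd⟩
    refine ⟨?_, ?_⟩
    · rintro ⟨i, j⟩ ⟨i', j'⟩ hne
      rw [Finset.disjoint_left]
      intro x hx hx'
      obtain ⟨s, hs, rfl⟩ := Finset.mem_image.1 hx
      obtain ⟨s', hs', h⟩ := Finset.mem_image.1 hx'
      simp only at hs hs' h
      have key : i = i' ∧ s = s' := by
        rcases le_total s s' with hle | hle
        · exact hd i i' s hs s' hs' hle (by omega)
        · have := hd i' i s' hs' s hs hle (by omega)
          exact ⟨this.1.symm, this.2.symm⟩
      obtain ⟨rfl, rfl⟩ := key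
      exact hne (by rw [show j = j' from Fin.ext (by omega)])
    · ext x
      simp only [Finset.mem_biUnion, Finset.mem_univ, true_and, Finset.mem_image,
        Finset.mem_range, Sigma.exists]
      constructor
      · rintro ⟨i, j, s, hs, rfl⟩
        have := hb i s hs
        omega
      · intro hx
        obtain ⟨i, s, hs, h1, h2⟩ := hc x hx
        exact ⟨i, ⟨x - s, by omega⟩, s, hs, by simp only; omega⟩

theorem mem_SPart {r n : ℕ} {S : Fin r → Finset ℕ} : S ∈ SPart r n ↔ SP r n S := by
  classical
  unfold SPart
  rw [Finset.mem_filter, and_iff_right_iff_imp]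
  intro h
  simp only [Fintype.mem_piFinset, Finset.mem_powerset]
  intro i s hs
  have := ((SP_iff r n S).1 h).1 i s hs
  exact Finset.mem_range.2 (by omega)

/-- Shift a tuple up by `i + 1` and put a tile of length `i + 1` at the origin. -/
def prependTile {r : ℕ} (i : Fin r) (S : Fin r → Finset ℕ) (j : Fin r) : Finset ℕ :=
  (if j = i then {0} else ∅) ∪ (S j).image (· + ((i : ℕ) + 1))

theorem mem_prependTile {r : ℕ} {i j : Fin r} {S : Fin r → Finset ℕ} {x : ℕ} :
    x ∈ prependTile i S j ↔
      (j = i ∧ x = 0) ∨ ((i : ℕ) + 1 ≤ x ∧ x - ((i : ℕ) + 1) ∈ S j) := by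
  have h : (∃ a ∈ S j, a + ((i : ℕ) + 1) = x) ↔
      ((i : ℕ) + 1 ≤ x ∧ x - ((i : ℕ) + 1) ∈ S j) := by
    constructor
    · rintro ⟨a, ha, rfl⟩
      exact ⟨by omega, by simpa using ha⟩
    · rintro ⟨h1, h2⟩
      exact ⟨_, h2, by omega⟩
  unfold prependTile
  rw [Finset.mem_union, Finset.mem_image, h]
  split_ifs with hj <;> simp [hj]

theorem zero_mem_prependTile {r : ℕ} {i j : Fin r} {S : Fin r → Finset ℕ} :
    0 ∈ prependTile i S j ↔ j = i := by
  simp [mem_prependTile]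

theorem prependTile_injective {r : ℕ} {i i' : Fin r} {S S' : Fin r → Finset ℕ}
    (h : prependTile i S = prependTile i' S') : i = i' ∧ S = S' := by
  have hi : i = i' := by
    rw [← zero_mem_prependTile (S := S'), ← h, zero_mem_prependTile]
  subst hi
  refine ⟨rfl, ?_⟩
  funext j
  ext x
  have := Finset.ext_iff.1 (congrFun h j) (x + (i + 1))
  simpa [mem_prependTile] using this

theorem SP_prependTile {r n : ℕ} {i : Fin r} {S : Fin r → Finset ℕ} (hi : (i : ℕ) + 1 ≤ n)
    (h : SP r (n - ((i : ℕ) + 1)) S) : SP r n (prependTile i S) := by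
  rw [SP_iff] at h ⊢
  obtain ⟨hb, hc, hd⟩ := h
  refine ⟨?_, ?_, ?_⟩
  · intro j s hs
    rcases mem_prependTile.1 hs with ⟨rfl, rfl⟩ | ⟨h1, h2⟩
    · omega
    · have := hb j _ h2
      omega
  · intro x hx
    by_cases hxi : x ≤ i
    · exact ⟨i, 0, zero_mem_prependTile.2 rfl, by omega, by omega⟩
    · obtain ⟨j, s, hs, h1, h2⟩ := hc (x - (i + 1)) (by omega)
      exact ⟨j, s + (i + 1), mem_prependTile.2 (Or.inr ⟨by omega, by simpa using hs⟩),
        by omega, by omega⟩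
  · intro j j' s hs s' hs' h1 h2
    rcases mem_prependTile.1 hs with ⟨rfl, rfl⟩ | ⟨a1, a2⟩ <;>
    rcases mem_prependTile.1 hs' with ⟨rfl, rfl⟩ | ⟨b1, b2⟩
    · exact ⟨rfl, rfl⟩
    · omega
    · omega
    · have := hd j j' _ a2 _ b2 (by omega) (by omega)
      exact ⟨this.1, by omega⟩

theorem SP.exists_eq_prependTile {r n : ℕ} {S : Fin r → Finset ℕ} (hn : 1 ≤ n)
    (h : SP r n S) :
    ∃ i : Fin r, (i : ℕ) + 1 ≤ n ∧
      ∃ S', SP r (n - ((i : ℕ) + 1)) S' ∧ prependTile i S' = S := by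
  rw [SP_iff] at h
  obtain ⟨hb, hc, hd⟩ := h
  obtain ⟨i, s, hs, h1, -⟩ := hc 0 (by omega)
  obtain rfl : s = 0 := by omega
  have hin := hb i 0 hs
  have hgap : ∀ j, ∀ x ∈ S j, x ≤ i → j = i ∧ x = 0 := by
    intro j x hx hxi
    have := hd i j 0 hs x hx (by omega) (by omega)
    exact ⟨this.1.symm, this.2.symm⟩
  have hmem : ∀ (j : Fin r) (x : ℕ), x ∈ (Finset.range n).filter (fun k => k + ((i : ℕ) + 1) ∈ S j) ↔
      x + ((i : ℕ) + 1) ∈ S j := by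
    intro j x
    rw [Finset.mem_filter, and_iff_right_iff_imp]
    intro hx
    have := hb j _ hx
    exact Finset.mem_range.2 (by omega)
  refine ⟨i, by omega, fun j => (Finset.range n).filter (fun k => k + ((i : ℕ) + 1) ∈ S j), ?_, ?_⟩
  · rw [SP_iff]
    simp only [hmem]
    refine ⟨?_, ?_, ?_⟩
    · intro j x hx
      have := hb j _ hx
      omega
    · intro x hx
      obtain ⟨j, s, hs, h1, h2⟩ := hc (x + (i + 1)) (by omega)
      have hsi : (i : ℕ) + 1 ≤ s := by
        by_contra hlt
        obtain ⟨rfl, rfl⟩ := hgap j s hs (by omega)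
        omega
      exact ⟨j, s - (i + 1), by rwa [Nat.sub_add_cancel hsi], by omega, by omega⟩
    · intro j j' s hs s' hs' h1 h2
      have := hd j j' _ hs _ hs' (by omega) (by omega)
      exact ⟨this.1, by omega⟩
  · funext j
    ext x
    rw [mem_prependTile, hmem]
    constructor
    · rintro (⟨rfl, rfl⟩ | ⟨h1, h2⟩)
      · exact hs
      · rwa [Nat.sub_add_cancel h1] at h2
    · intro hx
      by_cases hxi : x ≤ i
      · exact Or.inl (hgap j x hx hxi)
      · exact Or.inr ⟨by omega, by rwa [Nat.sub_add_cancel (by omega)]⟩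

theorem sum_prependTile {r : ℕ} (q : ℕ) (i j : Fin r) (S : Fin r → Finset ℕ) :
    ∑ k ∈ prependTile i S j, q ^ k =
      (if j = i then 1 else 0) + (∑ k ∈ S j, q ^ k) * q ^ ((i : ℕ) + 1) := by
  unfold prependTile
  rw [Finset.sum_union, Finset.sum_image (fun a _ b _ h => Nat.add_right_cancel h)]
  · congr 1
    · split_ifs <;> simp
    · simp only [pow_add, Finset.sum_mul]
  · rw [Finset.disjoint_left]
    intro x hx hx'
    obtain ⟨a, -, rfl⟩ := Finset.mem_image.1 hx'
    split_ifs at hx <;> simp at hx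

theorem biUnion_prependTile {r : ℕ} (i : Fin r) (S : Fin r → Finset ℕ) :
    Finset.univ.biUnion (prependTile i S) =
      insert 0 ((Finset.univ.biUnion S).image (· + ((i : ℕ) + 1))) := by
  ext x
  simp only [Finset.mem_biUnion, Finset.mem_univ, true_and, Finset.mem_insert, Finset.mem_image]
  constructor
  · rintro ⟨j, hj⟩
    rcases mem_prependTile.1 hj with ⟨-, rfl⟩ | ⟨h1, h2⟩
    · exact Or.inl rfl
    · exact Or.inr ⟨_, ⟨j, h2⟩, by omega⟩
  · rintro (rfl | ⟨a, ⟨j, hj⟩, rfl⟩)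
    · exact ⟨i, zero_mem_prependTile.2 rfl⟩
    · exact ⟨j, mem_prependTile.2 (Or.inr ⟨by omega, by simpa using hj⟩)⟩

/-- The summand of `expCoeff` attached to a tuple `S`. -/
noncomputable def expTerm (q : ℕ) {L : Type*} [Field L] (T : L) {r : ℕ}
    (A : Fin r → L) (n : ℕ) (S : Fin r → Finset ℕ) : L :=
  (∏ i : Fin r, A i ^ ∑ j ∈ S i, q ^ j) /
    ∏ i ∈ Finset.univ.biUnion S, (T ^ q ^ (n - i) - T) ^ q ^ i

theorem expTerm_prependTile (q : ℕ) {L : Type*} [Field L] (T : L) {r : ℕ}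
    (A : Fin r → L) (n : ℕ) (i : Fin r) (S : Fin r → Finset ℕ) :
    expTerm q T A n (prependTile i S) =
      A i * expTerm q T A (n - ((i : ℕ) + 1)) S ^ q ^ ((i : ℕ) + 1) / (T ^ q ^ n - T) := by
  have hnum : ∏ j : Fin r, A j ^ ∑ k ∈ prependTile i S j, q ^ k =
      A i * (∏ j : Fin r, A j ^ ∑ k ∈ S j, q ^ k) ^ q ^ ((i : ℕ) + 1) := by
    simp only [sum_prependTile, pow_add, Finset.prod_mul_distrib, pow_mul, Finset.prod_pow,
      pow_ite, pow_one, pow_zero, Finset.prod_ite_eq', Finset.mem_univ, if_true]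
  have hden : ∏ k ∈ Finset.univ.biUnion (prependTile i S), (T ^ q ^ (n - k) - T) ^ q ^ k =
      (T ^ q ^ n - T) * (∏ k ∈ Finset.univ.biUnion S,
        (T ^ q ^ (n - ((i : ℕ) + 1) - k) - T) ^ q ^ k) ^ q ^ ((i : ℕ) + 1) := by
    rw [biUnion_prependTile, Finset.prod_insert (by simp),
      Finset.prod_image (fun a _ b _ h => Nat.add_right_cancel h), ← Finset.prod_pow]
    congr 1
    · simp
    · refine Finset.prod_congr rfl fun k _ => ?_
      rw [← pow_mul, ← pow_add, Nat.sub_sub, Nat.add_comm k]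
  unfold expTerm
  rw [hnum, hden, div_pow, mul_div_assoc, mul_div_assoc, div_div,
    mul_comm (T ^ q ^ n - T)]

theorem expCoeff_zero (q : ℕ) {L : Type*} [Field L] (T : L) {r : ℕ} (A : Fin r → L) :
    expCoeff q T A 0 = 1 := by
  have h : SPart r 0 = {fun _ => ∅} := by
    ext S
    rw [mem_SPart, Finset.mem_singleton, SP_iff]
    constructor
    · rintro ⟨hb, -, -⟩
      funext i
      exact Finset.eq_empty_of_forall_notMem fun s hs => absurd (hb i s hs) (by omega)
    · rintro rfl
      simp
  have hU : (Finset.univ.biUnion fun _ : Fin r => (∅ : Finset ℕ)) = ∅ := by ext; simp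
  simp [expCoeff, h, hU]

theorem expCoeff_eq_sum (q : ℕ) {L : Type*} [Field L] (T : L) {r : ℕ} (A : Fin r → L)
    {n : ℕ} (hn : 1 ≤ n) :
    expCoeff q T A n =
      ∑ i ∈ Finset.univ.filter (fun i : Fin r => (i : ℕ) + 1 ≤ n),
        ∑ S ∈ SPart r (n - ((i : ℕ) + 1)), expTerm q T A n (prependTile i S) := by
  rw [Finset.sum_sigma', eq_comm]
  refine Finset.sum_bij (fun x _ => prependTile x.1 x.2) ?_ ?_ ?_ (fun _ _ => rfl)
  · rintro ⟨i, S⟩ hx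
    simp only [Finset.mem_sigma, Finset.mem_filter, Finset.mem_univ, true_and, mem_SPart] at hx
    exact mem_SPart.2 (SP_prependTile hx.1 hx.2)
  · rintro ⟨i, S⟩ - ⟨i', S'⟩ - h
    obtain ⟨rfl, rfl⟩ := prependTile_injective h
    rfl
  · intro S hS
    obtain ⟨i, hi, S', hS', h⟩ := (mem_SPart.1 hS).exists_eq_prependTile hn
    exact ⟨⟨i, S'⟩, by simpa [mem_SPart] using ⟨hi, hS'⟩, h⟩

theorem expCoeff_recursion (p s : ℕ) (hp : p.Prime) {L : Type*} [Field L] [CharP L p]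
    {T : L} {r : ℕ} (A : Fin r → L) {n : ℕ} (hn : 1 ≤ n) (hT : T ^ (p ^ s) ^ n ≠ T) :
    expCoeff (p ^ s) T A n * T ^ (p ^ s) ^ n =
      T * expCoeff (p ^ s) T A n +
        ∑ i : Fin r, A i *
          (if (i : ℕ) + 1 ≤ n then
            expCoeff (p ^ s) T A (n - ((i : ℕ) + 1)) ^ (p ^ s) ^ ((i : ℕ) + 1) else 0) := by
  have : Fact p.Prime := ⟨hp⟩
  have hne : T ^ (p ^ s) ^ n - T ≠ 0 := sub_ne_zero.2 hT
  have key : expCoeff (p ^ s) T A n * (T ^ (p ^ s) ^ n - T) = ∑ i : Fin r, A i *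
      (if (i : ℕ) + 1 ≤ n then
        expCoeff (p ^ s) T A (n - ((i : ℕ) + 1)) ^ (p ^ s) ^ ((i : ℕ) + 1) else 0) := by
    simp only [mul_ite, mul_zero]
    rw [expCoeff_eq_sum _ _ _ hn, ← Finset.sum_filter, Finset.sum_mul]
    refine Finset.sum_congr rfl fun i _ => ?_
    simp only [expTerm_prependTile]
    rw [← Finset.sum_div, div_mul_cancel₀ _ hne, ← Finset.mul_sum, ← pow_mul p,
      ← sum_pow_char_pow p]
    rfl
  linear_combination key

/-- Let `q = p^s` be a prime power, `L` a field extension of `𝔽_q(T)` (encoded: `L` of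
characteristic `p`, `T ∈ L` with `T^{q^m} ≠ T` for all `m ≥ 1`), `r ≥ 1` and
`A_1, …, A_r ∈ L`, with `A_0 := T`.  Then `α_0 = 1`, the `α_n` satisfy the recursion
`α_n T^{q^n} = ∑_{i=0}^r A_i α_{n-i}^{q^i}` (terms with negative index being `0`),
and `(α_n)` is the unique such sequence with `α_0 = 1`: these are the coefficients of the
exponential `e_φ(z) = ∑ α_n z^{q^n}` of `φ_T = T + A_1 τ + ⋯ + A_r τ^r`. -/
theorem expCoeff_recursion_unique (p q s : ℕ) (hp : p.Prime) (hs : 1 ≤ s) (hq : q = p ^ s)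
    (L : Type*) [Field L] [CharP L p] (T : L) (hT : ∀ m : ℕ, 1 ≤ m → T ^ q ^ m ≠ T)
    (r : ℕ) (hr : 1 ≤ r) (A : Fin r → L) :
    expCoeff q T A 0 = 1 ∧
    (∀ n : ℕ, 1 ≤ n →
      expCoeff q T A n * T ^ q ^ n =
        T * expCoeff q T A n +
          ∑ i : Fin r, A i *
            (if (i : ℕ) + 1 ≤ n then
              expCoeff q T A (n - ((i : ℕ) + 1)) ^ q ^ ((i : ℕ) + 1) else 0)) ∧
    (∀ γ : ℕ → L,
      (γ 0 = 1 ∧ ∀ n : ℕ, 1 ≤ n →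
        γ n * T ^ q ^ n =
          T * γ n +
            ∑ i : Fin r, A i *
              (if (i : ℕ) + 1 ≤ n then γ (n - ((i : ℕ) + 1)) ^ q ^ ((i : ℕ) + 1) else 0)) →
      γ = expCoeff q T A) := by
  subst hq
  have hrec := fun n hn => expCoeff_recursion p s hp A (n := n) hn (hT n hn)
  refine ⟨expCoeff_zero _ T A, hrec, ?_⟩
  rintro γ ⟨h0, hγ⟩
  funext n
  induction n using Nat.strong_induction_on with
  | _ n ih =>
    rcases Nat.eq_zero_or_pos n with rfl | hn
    · rw [h0, expCoeff_zero]
    · have hsum : ∑ i : Fin r, A i * (if (i : ℕ) + 1 ≤ n then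
            γ (n - ((i : ℕ) + 1)) ^ (p ^ s) ^ ((i : ℕ) + 1) else 0) =
          ∑ i : Fin r, A i * (if (i : ℕ) + 1 ≤ n then
            expCoeff (p ^ s) T A (n - ((i : ℕ) + 1)) ^ (p ^ s) ^ ((i : ℕ) + 1) else 0) :=
        Finset.sum_congr rfl fun i _ => by rw [ih _ (by omega)]
      refine mul_right_cancel₀ (sub_ne_zero.2 (hT n hn)) ?_
      linear_combination hγ n hn - hrec n hn + hsum
end

section
/- Let q be a power of a prime p, let L be a field extension of 𝔽_q(T), complete with respect to an additive valuation v satisfying v(T) = −1, let A, B ∈ L with B ≠ 0, and let β_n be the logarithm coefficients of φ_T = T + Aτ + Bτ². If z ∈ L is nonzero and v(z) > ρ_φ := max(−(q + v(A))/(q − 1), −(q² + v(B))/(q² − 1)), then v(β_n z^{q^n}) > v(z) for every n ≥ 1, and consequently the sum log_φ(z) = ∑_{n≥0} β_n z^{q^n} converges and satisfies v(log_φ(z)) = v(z). -/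
/-- `x` is the limit of the sequence `f` with respect to the additive valuation `v`
(valued in `ℝ ∪ {∞} = ` `EReal`): `v (f n - x) → ∞`. -/
def IsVLimit {L : Type*} [Field L] (v : L → EReal) (f : ℕ → L) (x : L) : Prop :=
  ∀ M : ℝ, ∃ N : ℕ, ∀ n : ℕ, N ≤ n → (M : EReal) < v (f n - x)

/-- `v` is an additive valuation on the field `L` with values in `ℝ ∪ {∞}`. -/
structure IsRealAddValuation {L : Type*} [Field L] (v : L → EReal) : Prop where
  eq_top_iff : ∀ x, v x = ⊤ ↔ x = 0
  ne_bot : ∀ x, v x ≠ ⊥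
  map_mul : ∀ x y, v (x * y) = v x + v y
  min_le_map_add : ∀ x y, min (v x) (v y) ≤ v (x + y)

namespace IsRealAddValuation

variable {L : Type*} [Field L] {v : L → EReal}

theorem map_zero (hv : IsRealAddValuation v) : v 0 = ⊤ := (hv.eq_top_iff 0).2 rfl

theorem exists_real (hv : IsRealAddValuation v) {x : L} (hx : x ≠ 0) :
    ∃ r : ℝ, v x = r :=
  ⟨(v x).toReal, (EReal.coe_toReal (mt (hv.eq_top_iff x).1 hx) (hv.ne_bot x)).symm⟩

theorem map_one (hv : IsRealAddValuation v) : v 1 = 0 := by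
  obtain ⟨r, hr⟩ := hv.exists_real (one_ne_zero (α := L))
  have h := hv.map_mul 1 1
  rw [mul_one, hr, ← EReal.coe_add, EReal.coe_eq_coe_iff] at h
  rw [hr, show r = 0 by linarith, EReal.coe_zero]

theorem map_neg (hv : IsRealAddValuation v) (x : L) : v (-x) = v x := by
  obtain ⟨r, hr⟩ := hv.exists_real (neg_ne_zero.2 (one_ne_zero (α := L)))
  have h := hv.map_mul (-1) (-1)
  rw [neg_mul_neg, mul_one, hv.map_one, hr, ← EReal.coe_add, ← EReal.coe_zero,
    EReal.coe_eq_coe_iff] at h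
  rw [← neg_one_mul, hv.map_mul, hr, show r = 0 by linarith, EReal.coe_zero, zero_add]

theorem le_map_add (hv : IsRealAddValuation v) {r : EReal} {x y : L} (hx : r ≤ v x)
    (hy : r ≤ v y) : r ≤ v (x + y) :=
  (le_min hx hy).trans (hv.min_le_map_add x y)

theorem le_map_sub (hv : IsRealAddValuation v) {r : EReal} {x y : L} (hx : r ≤ v x)
    (hy : r ≤ v y) : r ≤ v (x - y) := by
  rw [sub_eq_add_neg]
  exact hv.le_map_add hx (by rwa [hv.map_neg])

theorem le_map_sum (hv : IsRealAddValuation v) {ι : Type*} {r : EReal} (s : Finset ι)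
    (f : ι → L) (h : ∀ i ∈ s, r ≤ v (f i)) : r ≤ v (∑ i ∈ s, f i) :=
  Finset.sum_induction f (fun x => r ≤ v x) (fun _ _ => hv.le_map_add)
    (by rw [hv.map_zero]; exact le_top) h

theorem map_add_eq_left (hv : IsRealAddValuation v) {x y : L} (h : v x < v y) :
    v (x + y) = v x := by
  refine le_antisymm ?_ (hv.le_map_add le_rfl h.le)
  by_contra! hlt
  have := hv.min_le_map_add (x + y) (-y)
  rw [hv.map_neg, add_neg_cancel_right] at this
  exact absurd this (not_le.2 (lt_min hlt h))

theorem map_pow_of_eq_coe (hv : IsRealAddValuation v) {x : L} {r : ℝ} (hx : v x = r)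
    (n : ℕ) : v (x ^ n) = ((n * r : ℝ) : EReal) := by
  induction n with
  | zero => simp [hv.map_one]
  | succ n ih =>
    rw [pow_succ, hv.map_mul, ih, hx, ← EReal.coe_add]
    rw [Nat.cast_succ, add_one_mul]

theorem le_map_pow (hv : IsRealAddValuation v) {x : L} {r : ℝ} (hx : (r : EReal) ≤ v x)
    {n : ℕ} (hn : n ≠ 0) : ((n * r : ℝ) : EReal) ≤ v (x ^ n) := by
  by_cases h0 : x = 0
  · rw [h0, zero_pow hn, hv.map_zero]
    exact le_top
  · obtain ⟨a, ha⟩ := hv.exists_real h0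
    rw [ha, EReal.coe_le_coe_iff] at hx
    rw [hv.map_pow_of_eq_coe ha, EReal.coe_le_coe_iff]
    gcongr

theorem le_map_mul (hv : IsRealAddValuation v) {x y : L} {r s : ℝ} (hx : (r : EReal) ≤ v x)
    (hy : (s : EReal) ≤ v y) : ((r + s : ℝ) : EReal) ≤ v (x * y) := by
  rw [hv.map_mul, EReal.coe_add]
  exact add_le_add hx hy

theorem le_map_of_mul_eq (hv : IsRealAddValuation v) {x y w : L} {d r : ℝ} (hx : v x = d)
    (h : x * y = w) (hw : (r : EReal) ≤ v w) : ((r - d : ℝ) : EReal) ≤ v y := by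
  by_cases h0 : y = 0
  · rw [h0, hv.map_zero]
    exact le_top
  · obtain ⟨a, ha⟩ := hv.exists_real h0
    rw [← h, hv.map_mul, hx, ha, ← EReal.coe_add, EReal.coe_le_coe_iff] at hw
    rw [ha, EReal.coe_le_coe_iff]
    linarith

theorem map_neg_pow_sub_self (hv : IsRealAddValuation v) {T : L} (hT : v T = -1) {m : ℕ}
    (hm : 1 < m) : v (-(T ^ m - T)) = ((-m : ℝ) : EReal) := by
  have hT' : v T = ((-1 : ℝ) : EReal) := by rw [hT]; rfl
  have hpow := hv.map_pow_of_eq_coe hT' m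
  have hm' : (1 : ℝ) < m := by exact_mod_cast hm
  rw [hv.map_neg, sub_eq_add_neg, hv.map_add_eq_left, hpow, mul_neg_one]
  rw [hpow, hv.map_neg, hT', EReal.coe_lt_coe_iff]
  linarith

/-- The condition `v z > -(Q + v A) / (Q - 1)` says that `v (A z ^ (Q - 1)) > -Q`. -/
theorem exists_pos_le_map_mul_pow (hv : IsRealAddValuation v) {Q : ℕ} (hQ : 1 < Q) (A : L)
    {z : L} {c : ℝ} (hc : v z = c)
    (h : -(((Q : ℝ) : EReal) + v A) * ((((Q : ℝ) - 1)⁻¹ : ℝ) : EReal) < v z) :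
    ∃ δ : ℝ, 0 < δ ∧ ((-Q + δ : ℝ) : EReal) ≤ v (A * z ^ (Q - 1)) := by
  by_cases hA : A = 0
  · refine ⟨1, one_pos, ?_⟩
    rw [hA, zero_mul, hv.map_zero]
    exact le_top
  · obtain ⟨a, ha⟩ := hv.exists_real hA
    have hQ' : (0 : ℝ) < Q - 1 := by
      rw [sub_pos]
      exact_mod_cast hQ
    rw [ha, hc, ← EReal.coe_add, ← EReal.coe_neg, ← EReal.coe_mul, EReal.coe_lt_coe_iff,
      ← div_eq_mul_inv, div_lt_iff₀ hQ'] at h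
    refine ⟨Q + a + (Q - 1) * c, by linarith, ?_⟩
    rw [hv.map_mul, ha, hv.map_pow_of_eq_coe hc, ← EReal.coe_add, EReal.coe_le_coe_iff,
      Nat.cast_sub hQ.le, Nat.cast_one]
    linarith

/-- If `v C ≥ -Q + δ`, then multiplying by `C ^ m` and dividing by an element of value
`-(m * Q)` raises values by at least `δ`. -/
theorem le_map_pow_mul (hv : IsRealAddValuation v) {C u : L} {Q δ r : ℝ} (hδ : 0 ≤ δ)
    (hC : ((-Q + δ : ℝ) : EReal) ≤ v C) (hu : (r : EReal) ≤ v u) {m : ℕ} (hm : m ≠ 0) :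
    ((r + δ - m * Q : ℝ) : EReal) ≤ v (C ^ m * u) := by
  refine le_trans (EReal.coe_le_coe_iff.2 ?_) (hv.le_map_mul (hv.le_map_pow hC hm) hu)
  have h1 : (1 : ℝ) ≤ m := by exact_mod_cast Nat.one_le_iff_ne_zero.2 hm
  nlinarith

/-- Linear growth of the values of the terms of the logarithm series. -/
theorem le_map_logTerm (hv : IsRealAddValuation v) {q : ℕ} (hq : 1 < q) {T : L}
    (hT : v T = -1) {A B : L} {β : ℕ → L} (hβ0 : β 0 = 1)
    (hβ1 : -(T ^ q ^ 1 - T) * β 1 = A * β 0)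
    (hβ : ∀ n : ℕ,
      -(T ^ q ^ (n + 2) - T) * β (n + 2) = A ^ q ^ (n + 1) * β (n + 1) + B ^ q ^ n * β n)
    {z : L} {c δ : ℝ} (hc : v z = c) (hδ : 0 < δ)
    (hA : ((-q + δ : ℝ) : EReal) ≤ v (A * z ^ (q - 1)))
    (hB : ((-(q ^ 2 : ℕ) + δ : ℝ) : EReal) ≤ v (B * z ^ (q ^ 2 - 1))) (n : ℕ) :
    ((c + n * (δ / 2) : ℝ) : EReal) ≤ v (β n * z ^ q ^ n) := by
  have hq0 : ∀ n, q ^ n ≠ 0 := fun n => pow_ne_zero n (by omega)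
  have hz1 : ∀ n, z ^ q ^ (n + 1) = (z ^ (q - 1)) ^ q ^ n * z ^ q ^ n := fun n => by
    obtain ⟨k, rfl⟩ : ∃ k, q = k + 1 := ⟨q - 1, by omega⟩
    rw [← pow_mul, ← pow_add, Nat.add_sub_cancel]
    ring_nf
  have hz2 : ∀ n, z ^ q ^ (n + 2) = (z ^ (q ^ 2 - 1)) ^ q ^ n * z ^ q ^ n := fun n => by
    obtain ⟨k, hk⟩ : ∃ k, q ^ 2 = k + 1 := ⟨q ^ 2 - 1, by have := hq0 2; omega⟩
    rw [← pow_mul, ← pow_add, pow_add q n 2, hk, Nat.add_sub_cancel]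
    ring_nf
  induction n using Nat.twoStepInduction with
  | zero => simp [hβ0, hc]
  | one =>
    have hrec : -(T ^ q ^ 1 - T) * (β 1 * z ^ q ^ 1) = (A * z ^ (q - 1)) ^ 1 * z := by
      rw [← mul_assoc, hβ1, hβ0, hz1 0]
      ring
    refine le_trans (EReal.coe_le_coe_iff.2 ?_) (hv.le_map_of_mul_eq
      (hv.map_neg_pow_sub_self hT (Nat.one_lt_pow one_ne_zero hq)) hrec
      (hv.le_map_pow_mul hδ.le hA hc.ge one_ne_zero))
    push_cast
    linarith
  | more n ih0 ih1 =>
    have hrec : -(T ^ q ^ (n + 2) - T) * (β (n + 2) * z ^ q ^ (n + 2)) =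
        (A * z ^ (q - 1)) ^ q ^ (n + 1) * (β (n + 1) * z ^ q ^ (n + 1)) +
          (B * z ^ (q ^ 2 - 1)) ^ q ^ n * (β n * z ^ q ^ n) := by
      rw [← mul_assoc, hβ, add_mul]
      congr 1
      · rw [hz1 (n + 1), mul_pow]
        ring
      · rw [hz2, mul_pow]
        ring
    have hw : ((c + (n + 2) * (δ / 2) - q ^ (n + 2) : ℝ) : EReal) ≤
        v ((A * z ^ (q - 1)) ^ q ^ (n + 1) * (β (n + 1) * z ^ q ^ (n + 1)) +
          (B * z ^ (q ^ 2 - 1)) ^ q ^ n * (β n * z ^ q ^ n)) := by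
      refine hv.le_map_add
        (le_trans (EReal.coe_le_coe_iff.2 ?_) (hv.le_map_pow_mul hδ.le hA ih1 (hq0 (n + 1))))
        (le_trans (EReal.coe_le_coe_iff.2 ?_) (hv.le_map_pow_mul hδ.le hB ih0 (hq0 n)))
      · push_cast
        rw [← pow_succ]
        linarith
      · push_cast
        rw [← pow_add]
        linarith
    refine le_trans (EReal.coe_le_coe_iff.2 ?_) (hv.le_map_of_mul_eq
      (hv.map_neg_pow_sub_self hT (Nat.one_lt_pow (by omega) hq)) hrec hw)
    push_cast
    linarith

/-- Partial sums of a series whose terms have linearly growing values. -/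
theorem le_map_sum_range_sub (hv : IsRealAddValuation v) {u : ℕ → L} {c ε : ℝ} (hε : 0 < ε)
    (hu : ∀ n : ℕ, ((c + n * ε : ℝ) : EReal) ≤ v (u n)) {N m : ℕ} (h : N ≤ m) :
    ((c + N * ε : ℝ) : EReal) ≤ v (∑ n ∈ Finset.range m, u n - ∑ n ∈ Finset.range N, u n) := by
  rw [← Finset.sum_Ico_eq_sub _ h]
  refine hv.le_map_sum _ _ fun i hi => le_trans (EReal.coe_le_coe_iff.2 ?_) (hu i)
  have : (N : ℝ) ≤ i := by exact_mod_cast (Finset.mem_Ico.1 hi).1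
  gcongr

theorem isVCauchy_sum_range (hv : IsRealAddValuation v) {u : ℕ → L} {c ε : ℝ} (hε : 0 < ε)
    (hu : ∀ n : ℕ, ((c + n * ε : ℝ) : EReal) ≤ v (u n)) (M : ℝ) :
    ∃ N : ℕ, ∀ m : ℕ, N ≤ m → ∀ n : ℕ, N ≤ n →
      (M : EReal) < v (∑ i ∈ Finset.range m, u i - ∑ i ∈ Finset.range n, u i) := by
  obtain ⟨N, hN⟩ := exists_nat_gt ((M - c) / ε)
  rw [div_lt_iff₀ hε] at hN
  refine ⟨N, fun m hm n hn => lt_of_lt_of_le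
    (EReal.coe_lt_coe_iff.2 (show M < c + N * ε by linarith)) ?_⟩
  rw [← sub_sub_sub_cancel_right _ _ (∑ i ∈ Finset.range N, u i)]
  exact hv.le_map_sub (hv.le_map_sum_range_sub hε hu hm) (hv.le_map_sum_range_sub hε hu hn)

theorem map_eq_of_isVLimit_sum_range (hv : IsRealAddValuation v) {u : ℕ → L} {c ε : ℝ}
    (hε : 0 < ε) (hu : ∀ n : ℕ, ((c + n * ε : ℝ) : EReal) ≤ v (u n)) (h0 : v (u 0) = c) {x : L}
    (hx : IsVLimit v (fun N => ∑ n ∈ Finset.range N, u n) x) : v x = v (u 0) := by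
  obtain ⟨N, hN⟩ := hx (c + ε)
  have htail := hv.le_map_sum_range_sub hε hu (le_max_right N 1)
  rw [Finset.sum_range_one, Nat.cast_one, one_mul] at htail
  have hdiff := hv.le_map_sub htail (hN (max N 1) (le_max_left N 1)).le
  rw [sub_sub_sub_cancel_left] at hdiff
  have hlt : v (u 0) < v (x - u 0) := by
    rw [h0]
    exact lt_of_lt_of_le (EReal.coe_lt_coe_iff.2 (by linarith)) hdiff
  rw [← hv.map_add_eq_left hlt, add_sub_cancel]

end IsRealAddValuation

/-- Let `q = p^s` be a prime power, `L` a field extension of `𝔽_q(T)`, complete with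
respect to an additive valuation `v` (valued in `ℝ ∪ {∞} = ` `EReal`, `v x = ⊤ ↔ x = 0`)
with `v T = -1`, and let `β_n` be the logarithm coefficients of `φ_T = T + A τ + B τ²`
(`B ≠ 0`).  If `z ≠ 0` and `v z > ρ_φ := max (-(q + v A)/(q-1), -(q² + v B)/(q²-1))`,
then `v (β_n z^{q^n}) > v z` for every `n ≥ 1`, and consequently the sum
`log_φ(z) = ∑_{n≥0} β_n z^{q^n}` converges and satisfies `v (log_φ z) = v z`. -/
theorem logCoeff_value_of_log (p q s : ℕ) (hp : p.Prime) (hs : 1 ≤ s) (hq : q = p ^ s)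
    (L : Type*) [Field L] [CharP L p]
    (v : L → EReal) (hv0 : ∀ x : L, v x = ⊤ ↔ x = 0) (hvb : ∀ x : L, v x ≠ ⊥)
    (hvm : ∀ x y : L, v (x * y) = v x + v y)
    (hva : ∀ x y : L, min (v x) (v y) ≤ v (x + y))
    (hcomp : ∀ f : ℕ → L,
      (∀ M : ℝ, ∃ N : ℕ, ∀ m : ℕ, N ≤ m → ∀ n : ℕ, N ≤ n → (M : EReal) < v (f m - f n)) →
      ∃ x : L, IsVLimit v f x)
    (T : L) (hvT : v T = -1) (A B : L) (hB : B ≠ 0)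
    (β : ℕ → L) (hβ0 : β 0 = 1)
    (hβ1 : -(T ^ q ^ 1 - T) * β 1 = A * β 0)
    (hβ : ∀ n : ℕ,
      -(T ^ q ^ (n + 2) - T) * β (n + 2) = A ^ q ^ (n + 1) * β (n + 1) + B ^ q ^ n * β n)
    (z : L) (hz : z ≠ 0)
    (hvz : max (-(((q : ℝ) : EReal) + v A) * ((((q : ℝ) - 1)⁻¹ : ℝ) : EReal))
        (-((((q : ℝ) ^ 2 : ℝ) : EReal) + v B) * ((((q : ℝ) ^ 2 - 1)⁻¹ : ℝ) : EReal))
      < v z) :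
    (∀ n : ℕ, 1 ≤ n → v z < v (β n * z ^ q ^ n)) ∧
    (∃ x : L, IsVLimit v (fun N => ∑ n ∈ Finset.range N, β n * z ^ q ^ n) x) ∧
    (∀ x : L, IsVLimit v (fun N => ∑ n ∈ Finset.range N, β n * z ^ q ^ n) x →
      v x = v z) := by
  have hv : IsRealAddValuation v := ⟨hv0, hvb, hvm, hva⟩
  have hq1 : 1 < q := hq ▸ Nat.one_lt_pow (by omega) hp.one_lt
  obtain ⟨c, hc⟩ := hv.exists_real hz
  obtain ⟨hzA, hzB⟩ := max_lt_iff.1 hvz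
  obtain ⟨δA, hδA, hA⟩ := hv.exists_pos_le_map_mul_pow hq1 A hc hzA
  obtain ⟨δB, hδB, hB'⟩ := hv.exists_pos_le_map_mul_pow
    (Nat.one_lt_pow two_ne_zero hq1) B hc (by rwa [Nat.cast_pow])
  have hδ : 0 < min δA δB := lt_min hδA hδB
  have hterm := hv.le_map_logTerm hq1 hvT hβ0 hβ1 hβ hc hδ
    (le_trans (EReal.coe_le_coe_iff.2 (by gcongr; exact min_le_left _ _)) hA)
    (le_trans (EReal.coe_le_coe_iff.2 (by gcongr; exact min_le_right _ _)) hB')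
  have hε : 0 < min δA δB / 2 := half_pos hδ
  have hu0 : β 0 * z ^ q ^ 0 = z := by rw [hβ0, pow_zero, pow_one, one_mul]
  refine ⟨fun n hn => ?_, hcomp _ (hv.isVCauchy_sum_range hε hterm), fun x hx => ?_⟩
  · rw [hc]
    refine lt_of_lt_of_le (EReal.coe_lt_coe_iff.2 ?_) (hterm n)
    have : (0 : ℝ) < n := by exact_mod_cast hn
    exact lt_add_of_pos_right c (mul_pos this hε)
  · have h := hv.map_eq_of_isVLimit_sum_range hε hterm (by rw [hu0, hc]) hx
    rwa [hu0] at h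
end

section
/- Let q = p^s be a power of a prime p and let L be a field of characteristic p containing 𝔽_q, complete with respect to an additive valuation v. Let C, δ ∈ L be nonzero with v(C) > q·v(δ). Then v((C/δ^q)^{q^i}) → ∞ as i → ∞, so the series s := ∑_{i=0}^∞ (C/δ^q)^{q^i} converges in L, and the set of solutions x ∈ L of the equation x^q − δ^{q−1} x = C is exactly { aδ − δ·s : a ∈ 𝔽_q }. -/
section AdditiveValuation

variable {L : Type*} [Field L] {v : L → EReal}

lemma exists_real_eq_of_ne_zero (hv0 : ∀ x : L, v x = ⊤ ↔ x = 0) (hvb : ∀ x : L, v x ≠ ⊥)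
    {x : L} (hx : x ≠ 0) : ∃ r : ℝ, v x = r :=
  ⟨(v x).toReal, (EReal.coe_toReal (fun h => hx ((hv0 x).1 h)) (hvb x)).symm⟩

lemma addVal_one (hv0 : ∀ x : L, v x = ⊤ ↔ x = 0) (hvb : ∀ x : L, v x ≠ ⊥)
    (hvm : ∀ x y : L, v (x * y) = v x + v y) : v 1 = 0 := by
  obtain ⟨r, hr⟩ := exists_real_eq_of_ne_zero hv0 hvb (one_ne_zero (α := L))
  have h := hvm 1 1
  rw [mul_one, hr] at h
  norm_cast at h
  rw [hr, show r = 0 by linarith, EReal.coe_zero]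

lemma addVal_pow (hv0 : ∀ x : L, v x = ⊤ ↔ x = 0) (hvb : ∀ x : L, v x ≠ ⊥)
    (hvm : ∀ x y : L, v (x * y) = v x + v y) {x : L} {r : ℝ} (hr : v x = r) (n : ℕ) :
    v (x ^ n) = (n * r : ℝ) := by
  induction n with
  | zero => simp [addVal_one hv0 hvb hvm]
  | succ n ih =>
    rw [pow_succ, hvm, ih, hr]
    norm_cast
    push_cast
    ring

lemma addVal_neg (hv0 : ∀ x : L, v x = ⊤ ↔ x = 0) (hvb : ∀ x : L, v x ≠ ⊥)
    (hvm : ∀ x y : L, v (x * y) = v x + v y) (x : L) : v (-x) = v x := by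
  obtain ⟨r, hr⟩ := exists_real_eq_of_ne_zero hv0 hvb (neg_ne_zero.2 (one_ne_zero (α := L)))
  have h := hvm (-1) (-1)
  rw [neg_one_mul, neg_neg, addVal_one hv0 hvb hvm, hr] at h
  norm_cast at h
  rw [← neg_one_mul, hvm, hr, show r = 0 by linarith, EReal.coe_zero, zero_add]

lemma lt_addVal_sub (hv0 : ∀ x : L, v x = ⊤ ↔ x = 0) (hvb : ∀ x : L, v x ≠ ⊥)
    (hvm : ∀ x y : L, v (x * y) = v x + v y) (hva : ∀ x y : L, min (v x) (v y) ≤ v (x + y))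
    {M : EReal} {x y : L} (hx : M < v x) (hy : M < v y) : M < v (x - y) := by
  rw [sub_eq_add_neg]
  refine (lt_min hx ?_).trans_le (hva x (-y))
  rwa [addVal_neg hv0 hvb hvm]

lemma lt_addVal_pow (hv0 : ∀ x : L, v x = ⊤ ↔ x = 0) (hvb : ∀ x : L, v x ≠ ⊥)
    (hvm : ∀ x y : L, v (x * y) = v x + v y) {M : ℝ} (hM : 0 ≤ M) {n : ℕ} (hn : 1 ≤ n) {x : L}
    (hx : (M : EReal) < v x) : (M : EReal) < v (x ^ n) := by
  rcases eq_or_ne x 0 with rfl | h0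
  · rwa [zero_pow (by omega)]
  · obtain ⟨r, hr⟩ := exists_real_eq_of_ne_zero hv0 hvb h0
    rw [addVal_pow hv0 hvb hvm hr]
    rw [hr] at hx
    norm_cast at hx ⊢
    have : (1 : ℝ) ≤ n := by exact_mod_cast hn
    nlinarith

/-- A series in a complete field converges as soon as its terms tend to zero. -/
lemma exists_isVLimit_sum (hv0 : ∀ x : L, v x = ⊤ ↔ x = 0) (hvb : ∀ x : L, v x ≠ ⊥)
    (hvm : ∀ x y : L, v (x * y) = v x + v y) (hva : ∀ x y : L, min (v x) (v y) ≤ v (x + y))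
    (hcomp : ∀ f : ℕ → L,
      (∀ M : ℝ, ∃ N : ℕ, ∀ m : ℕ, N ≤ m → ∀ n : ℕ, N ≤ n → (M : EReal) < v (f m - f n)) →
      ∃ x : L, IsVLimit v f x)
    {g : ℕ → L} (hg : ∀ M : ℝ, ∃ N : ℕ, ∀ i : ℕ, N ≤ i → (M : EReal) < v (g i)) :
    ∃ x : L, IsVLimit v (fun N => ∑ i ∈ Finset.range N, g i) x := by
  refine hcomp _ fun M => ?_
  obtain ⟨N, hN⟩ := hg M
  have tail : ∀ n, N ≤ n → (M : EReal) <
      v (∑ i ∈ Finset.range n, g i - ∑ i ∈ Finset.range N, g i) := by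
    intro n hn
    induction n, hn using Nat.le_induction with
    | base => simp [(hv0 0).2 rfl]
    | succ n hn ih =>
      rw [Finset.sum_range_succ, add_sub_right_comm]
      exact (lt_min ih (hN n hn)).trans_le (hva _ _)
  refine ⟨N, fun m hm n hn => ?_⟩
  simpa using lt_addVal_sub hv0 hvb hvm hva (tail m hm) (tail n hn)

lemma lt_addVal_pow_pow (hv0 : ∀ x : L, v x = ⊤ ↔ x = 0) (hvb : ∀ x : L, v x ≠ ⊥)
    (hvm : ∀ x y : L, v (x * y) = v x + v y) {q : ℕ} (hq : 2 ≤ q) {u : L} {r : ℝ}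
    (hr : v u = r) (hr0 : 0 < r) (M : ℝ) :
    ∃ N : ℕ, ∀ i : ℕ, N ≤ i → (M : EReal) < v (u ^ q ^ i) := by
  obtain ⟨N, hN⟩ := exists_nat_gt (M / r)
  refine ⟨N, fun i hi => ?_⟩
  rw [addVal_pow hv0 hvb hvm hr]
  norm_cast
  rw [div_lt_iff₀ hr0] at hN
  have h : (N : ℝ) ≤ (q ^ i : ℕ) := by exact_mod_cast hi.trans (Nat.lt_pow_self hq).le
  exact hN.trans_le (mul_le_mul_of_nonneg_right h hr0.le)

/-- The sum `∑ u^{q^i}` solves the Artin–Schreier equation `S^q = S - u`. -/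
lemma pow_eq_sub_of_isVLimit {p q s : ℕ} (hp : p.Prime) (hq : q = p ^ s) [CharP L p]
    (hv0 : ∀ x : L, v x = ⊤ ↔ x = 0) (hvb : ∀ x : L, v x ≠ ⊥)
    (hvm : ∀ x y : L, v (x * y) = v x + v y) (hva : ∀ x y : L, min (v x) (v y) ≤ v (x + y))
    {u S : L} (hS : IsVLimit v (fun N => ∑ i ∈ Finset.range N, u ^ q ^ i) S) :
    S ^ q = S - u := by
  have : Fact p.Prime := ⟨hp⟩
  have hq1 : 1 ≤ q := hq ▸ Nat.one_le_pow _ _ hp.pos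
  have hfrob : ∀ N, (∑ i ∈ Finset.range N, u ^ q ^ i) ^ q =
      ∑ i ∈ Finset.range (N + 1), u ^ q ^ i - u := by
    intro N
    rw [Finset.sum_range_succ', pow_zero, pow_one, add_sub_cancel_right]
    simp only [pow_succ, pow_mul]
    subst hq
    exact sum_pow_char_pow p s _ _
  refine sub_eq_zero.1 ((hv0 _).1 (EReal.eq_top_iff_forall_lt _ |>.2 fun M => ?_))
  obtain ⟨N, hN⟩ := hS (max M 0)
  refine lt_of_le_of_lt (EReal.coe_le_coe_iff.2 (le_max_left M 0)) ?_
  have h := lt_addVal_sub hv0 hvb hvm hva (hN (N + 1) (Nat.le_succ N))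
    (lt_addVal_pow hv0 hvb hvm (le_max_right M 0) hq1 (hN N le_rfl))
  have hsub : (∑ i ∈ Finset.range N, u ^ q ^ i - S) ^ q =
      (∑ i ∈ Finset.range N, u ^ q ^ i) ^ q - S ^ q := by
    subst hq
    exact sub_pow_char_pow ..
  rw [hsub, hfrob] at h
  convert h using 2
  ring

end AdditiveValuation

/-- Rescaling by `δ` turns `x^q - δ^{q-1} x = C` into `a^q = a`, given a solution of the
normalised equation `S^q = S - C/δ^q`. -/
lemma pow_sub_mul_eq_iff {p q s : ℕ} (hp : p.Prime) (hq : q = p ^ s) {L : Type*} [Field L]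
    [CharP L p] {C δ S : L} (hδ : δ ≠ 0) (hS : S ^ q = S - C / δ ^ q) (x : L) :
    x ^ q - δ ^ (q - 1) * x = C ↔ ∃ a : L, a ^ q = a ∧ x = a * δ - δ * S := by
  have : Fact p.Prime := ⟨hp⟩
  have hq1 : 1 ≤ q := hq ▸ Nat.one_le_pow _ _ hp.pos
  have hadd : ∀ y z : L, (y + z) ^ q = y ^ q + z ^ q := by
    subst hq
    exact fun y z => add_pow_char_pow _ _ p s
  have hδq : δ ^ q = δ ^ (q - 1) * δ := by rw [← pow_succ, Nat.sub_add_cancel hq1]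
  have hδ' : δ ^ (q - 1) ≠ 0 := pow_ne_zero _ hδ
  have key : x ^ q - δ ^ (q - 1) * x = C ↔ (x / δ + S) ^ q = x / δ + S := by
    rw [hadd, hS, div_pow, hδq]
    field_simp
    constructor <;> intro h <;> linear_combination h
  rw [key]
  constructor
  · intro h
    exact ⟨_, h, by field_simp; ring⟩
  · rintro ⟨a, ha, rfl⟩
    rwa [show (a * δ - δ * S) / δ + S = a by field_simp; ring]

/-- Let `q = p^s` be a prime power and `L` a field of characteristic `p` containing `𝔽_q`
(encoded: `L` has `q` distinct elements `a` with `a^q = a`), complete with respect to an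
additive valuation `v` (valued in `ℝ ∪ {∞} = ` `EReal`, `v x = ⊤ ↔ x = 0`).  Let
`C, δ ∈ L` be nonzero with `v C > q · v δ`.  Then `v ((C/δ^q)^{q^i}) → ∞`, so the series
`s := ∑_{i≥0} (C/δ^q)^{q^i}` converges in `L`, and the solution set of
`x^q - δ^{q-1} x = C` is exactly `{aδ - δs : a ∈ 𝔽_q}`. -/
theorem artin_schreier_solutions (p q s : ℕ) (hp : p.Prime) (hs : 1 ≤ s) (hq : q = p ^ s)
    (L : Type*) [Field L] [CharP L p]
    (hFq : ∃ Φ : Finset L, Φ.card = q ∧ ∀ a ∈ Φ, a ^ q = a)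
    (v : L → EReal) (hv0 : ∀ x : L, v x = ⊤ ↔ x = 0) (hvb : ∀ x : L, v x ≠ ⊥)
    (hvm : ∀ x y : L, v (x * y) = v x + v y)
    (hva : ∀ x y : L, min (v x) (v y) ≤ v (x + y))
    (hcomp : ∀ f : ℕ → L,
      (∀ M : ℝ, ∃ N : ℕ, ∀ m : ℕ, N ≤ m → ∀ n : ℕ, N ≤ n → (M : EReal) < v (f m - f n)) →
      ∃ x : L, IsVLimit v f x)
    (C δ : L) (hC : C ≠ 0) (hδ : δ ≠ 0)
    (hvC : (((q : ℝ)) : EReal) * v δ < v C) :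
    (∀ M : ℝ, ∃ N : ℕ, ∀ i : ℕ, N ≤ i → (M : EReal) < v ((C / δ ^ q) ^ q ^ i)) ∧
    (∃ sum : L, IsVLimit v (fun N => ∑ i ∈ Finset.range N, (C / δ ^ q) ^ q ^ i) sum) ∧
    (∀ sum : L, IsVLimit v (fun N => ∑ i ∈ Finset.range N, (C / δ ^ q) ^ q ^ i) sum →
      ∀ x : L, x ^ q - δ ^ (q - 1) * x = C ↔
        ∃ a : L, a ^ q = a ∧ x = a * δ - δ * sum) := by
  have hq2 : 2 ≤ q := hq ▸ hp.two_le.trans (Nat.le_self_pow (by omega) p)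
  obtain ⟨r, hr⟩ := exists_real_eq_of_ne_zero hv0 hvb (div_ne_zero hC (pow_ne_zero q hδ))
  obtain ⟨d, hd⟩ := exists_real_eq_of_ne_zero hv0 hvb hδ
  have hr0 : 0 < r := by
    rw [← div_mul_cancel₀ C (pow_ne_zero q hδ), hvm, hr, addVal_pow hv0 hvb hvm hd, hd] at hvC
    norm_cast at hvC
    linarith
  have hterm := lt_addVal_pow_pow hv0 hvb hvm hq2 hr hr0
  exact ⟨hterm, exists_isVLimit_sum hv0 hvb hvm hva hcomp hterm, fun S hS =>
    pow_sub_mul_eq_iff hp hq hδ (pow_eq_sub_of_isVLimit hp hq hv0 hvb hvm hva hS)⟩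
end
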